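/- arXiv:2411.08445 — 2 statements merged into one kernel-verified Lean document; each statement's English description precedes it below -/
import Mathlib

section
/- Let a and b be effects on a complex Hilbert space H. Then a ⩕ b ≥ 0 if and only if there exist effects x, y, z with y z = 0 such that a = x + y and b = x + z; and in this case x + y + z = a ⩖ b. -/
variable {H : Type*} [NormedAddCommGroup H] [InnerProductSpace ℂ H] [CompleteSpace H]

/-- The absolute value of a bounded operator. -/
noncomputable def oabs (u : H →L[ℂ] H) : H →L[ℂ] H := CFC.sqrt (star u * u)

/-- A Hilbert space effect: between 0 and I in the Loewner order. -/
def IsEffect (a : H →L[ℂ] H) : Prop := 0 ≤ a ∧ a ≤ 1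

/-- The operation dotWedge. -/
noncomputable def dotWedge (a b : H →L[ℂ] H) : H →L[ℂ] H :=
  ((1:ℂ)/2) • (a + b - oabs (a - b))

/-- The operation dotVee. -/
noncomputable def dotVee (a b : H →L[ℂ] H) : H →L[ℂ] H :=
  ((1:ℂ)/2) • (a + b + oabs (a - b))

/-- Effects a, b are partially ortho-coexistent. -/
def PartiallyOrthoCoexistent (a b : H →L[ℂ] H) : Prop :=
  ∃ x y z : H →L[ℂ] H, IsEffect x ∧ IsEffect y ∧ IsEffect z ∧
    a = x + y ∧ b = x + z ∧ IsEffect (x + y + z) ∧ y * z = 0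

theorem oabs_sub_eq_add {y z : H →L[ℂ] H} (hy : 0 ≤ y) (hz : 0 ≤ z) (hyz : y * z = 0) :
    oabs (y - z) = y + z := by
  have hzy : z * y = 0 := by
    have h := congrArg star hyz
    rwa [star_mul, star_zero, (IsSelfAdjoint.of_nonneg hy).star_eq,
      (IsSelfAdjoint.of_nonneg hz).star_eq] at h
  refine CFC.sqrt_unique ?_ (add_nonneg hy hz)
  rw [star_sub, (IsSelfAdjoint.of_nonneg hy).star_eq, (IsSelfAdjoint.of_nonneg hz).star_eq]
  simp only [add_mul, mul_add, sub_mul, mul_sub, hyz, hzy]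
  abel

theorem dotWedge_add_add {x y z : H →L[ℂ] H} (hy : 0 ≤ y) (hz : 0 ≤ z) (hyz : y * z = 0) :
    dotWedge (x + y) (x + z) = x := by
  rw [dotWedge, add_sub_add_left_eq_sub, oabs_sub_eq_add hy hz hyz]
  module

theorem dotVee_add_add {x y z : H →L[ℂ] H} (hy : 0 ≤ y) (hz : 0 ≤ z) (hyz : y * z = 0) :
    dotVee (x + y) (x + z) = x + y + z := by
  rw [dotVee, add_sub_add_left_eq_sub, oabs_sub_eq_add hy hz hyz]
  module

theorem dotWedge_eq_sub_posPart {a b : H →L[ℂ] H} (hab : IsSelfAdjoint (a - b)) :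
    dotWedge a b = a - (a - b)⁺ := by
  have h : oabs (a - b) = (2 : ℂ) • (a - b)⁺ - (a - b) := by
    have h' := CFC.abs_add_self (a - b) hab
    rw [two_smul] at h'
    rw [two_smul, ← h', add_sub_cancel_right]
    rfl
  rw [dotWedge, h]
  module

theorem dotWedge_nonneg_iff (a b : H →L[ℂ] H)
    (ha : IsEffect a) (hb : IsEffect b) :
    (0 ≤ dotWedge a b ↔
      ∃ x y z : H →L[ℂ] H, IsEffect x ∧ IsEffect y ∧ IsEffect z ∧
        y * z = 0 ∧ a = x + y ∧ b = x + z) ∧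
    (∀ x y z : H →L[ℂ] H, IsEffect x → IsEffect y → IsEffect z →
      y * z = 0 → a = x + y → b = x + z → x + y + z = dotVee a b) := by
  refine ⟨⟨fun h => ?_, ?_⟩, ?_⟩
  · have hab : IsSelfAdjoint (a - b) :=
      (IsSelfAdjoint.of_nonneg ha.1).sub (IsSelfAdjoint.of_nonneg hb.1)
    have hy : 0 ≤ (a - b)⁺ := CFC.posPart_nonneg _
    have hz : 0 ≤ (a - b)⁻ := CFC.negPart_nonneg _
    have hya : a = dotWedge a b + (a - b)⁺ := by
      rw [dotWedge_eq_sub_posPart hab, sub_add_cancel]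
    have hzb : b = dotWedge a b + (a - b)⁻ := by
      have hd := CFC.posPart_sub_negPart (a - b) hab
      rw [dotWedge_eq_sub_posPart hab, sub_add, hd, sub_sub_cancel]
    exact ⟨dotWedge a b, (a - b)⁺, (a - b)⁻,
      ⟨h, (le_of_le_of_eq (le_add_of_nonneg_right hy) hya.symm).trans ha.2⟩,
      ⟨hy, (le_of_le_of_eq (le_add_of_nonneg_left h) hya.symm).trans ha.2⟩,
      ⟨hz, (le_of_le_of_eq (le_add_of_nonneg_left h) hzb.symm).trans hb.2⟩,
      CFC.posPart_mul_negPart _, hya, hzb⟩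
  · rintro ⟨x, y, z, hx, hy, hz, hyz, rfl, rfl⟩
    rw [dotWedge_add_add hy.1 hz.1 hyz]
    exact hx.1
  · rintro x y z - hy hz hyz rfl rfl
    exact (dotVee_add_add hy.1 hz.1 hyz).symm
end

section
/- Let a and b be effects on a complex Hilbert space H. Then |a - b| + |I - a - b| = I (i.e., a is absolutely compatible with b) if and only if there exist effects x, y, z, w such that a = x + y, b = x + z, y z = 0, x w = 0 and x + y + z + w = I. -/
variable {H : Type*} [NormedAddCommGroup H] [InnerProductSpace ℂ H] [CompleteSpace H]

theorem oabs_sub_of_mul_eq_zero {y z : H →L[ℂ] H} (hy : 0 ≤ y) (hz : 0 ≤ z) (h : y * z = 0) :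
    oabs (y - z) = y + z := by
  have hys : star y = y := (IsSelfAdjoint.of_nonneg hy).star_eq
  have hzs : star z = z := (IsSelfAdjoint.of_nonneg hz).star_eq
  have h' : z * y = 0 := by simpa [hys, hzs] using congrArg star h
  unfold oabs
  rw [CFC.sqrt_eq_iff _ _ (star_mul_self_nonneg _) (add_nonneg hy hz), star_sub, hys, hzs]
  simp [add_mul, mul_add, sub_mul, mul_sub, h, h']

theorem oabs_eq_posPart_add_negPart {u : H →L[ℂ] H} (hu : IsSelfAdjoint u) :
    oabs u = u⁺ + u⁻ := by
  rw [← oabs_sub_of_mul_eq_zero (CFC.posPart_nonneg u) (CFC.negPart_nonneg u)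
    (CFC.posPart_mul_negPart u), CFC.posPart_sub_negPart u hu]

theorem isEffect_of_add_eq_one {x r : H →L[ℂ] H} (hx : 0 ≤ x) (hr : 0 ≤ r) (h : x + r = 1) :
    IsEffect x :=
  ⟨hx, h ▸ le_add_of_nonneg_right hr⟩

theorem absolutelyCompatible_iff (a b : H →L[ℂ] H)
    (ha : IsEffect a) (hb : IsEffect b) :
    oabs (a - b) + oabs (1 - a - b) = 1 ↔
      ∃ x y z w : H →L[ℂ] H, IsEffect x ∧ IsEffect y ∧ IsEffect z ∧ IsEffect w ∧
        a = x + y ∧ b = x + z ∧ y * z = 0 ∧ x * w = 0 ∧ x + y + z + w = 1 := by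
  constructor
  · intro h
    have has : IsSelfAdjoint a := .of_nonneg ha.1
    have hbs : IsSelfAdjoint b := .of_nonneg hb.1
    have hu : IsSelfAdjoint (a - b) := has.sub hbs
    have hv : IsSelfAdjoint (1 - a - b) := ((IsSelfAdjoint.one _).sub has).sub hbs
    rw [oabs_eq_posPart_add_negPart hu, oabs_eq_posPart_add_negPart hv] at h
    have hyz := CFC.posPart_sub_negPart (a - b) hu
    have hwx := CFC.posPart_sub_negPart (1 - a - b) hv
    have hy := CFC.posPart_nonneg (a - b)
    have hz := CFC.negPart_nonneg (a - b)
    have hw := CFC.posPart_nonneg (1 - a - b)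
    have hx := CFC.negPart_nonneg (1 - a - b)
    have hmul_yz := CFC.posPart_mul_negPart (a - b)
    have hmul_xw := CFC.negPart_mul_posPart (1 - a - b)
    generalize (a - b)⁺ = y at *
    generalize (a - b)⁻ = z at *
    generalize (1 - a - b)⁺ = w at *
    generalize (1 - a - b)⁻ = x at *
    have hsum : x + y + z + w = 1 := by rw [← h]; abel
    refine ⟨x, y, z, w,
      isEffect_of_add_eq_one hx (add_nonneg (add_nonneg hy hz) hw) (by rw [← hsum]; abel),
      isEffect_of_add_eq_one hy (add_nonneg (add_nonneg hx hz) hw) (by rw [← hsum]; abel),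
      isEffect_of_add_eq_one hz (add_nonneg (add_nonneg hx hy) hw) (by rw [← hsum]; abel),
      isEffect_of_add_eq_one hw (add_nonneg (add_nonneg hx hy) hz) (by rw [← hsum]; abel),
      ?_, ?_, hmul_yz, hmul_xw, hsum⟩
    · linear_combination (norm := module)
        (1 / 2 : ℂ) • hwx - (1 / 2 : ℂ) • hsum - (1 / 2 : ℂ) • hyz
    · linear_combination (norm := module)
        (1 / 2 : ℂ) • hwx - (1 / 2 : ℂ) • hsum + (1 / 2 : ℂ) • hyz
  · rintro ⟨x, y, z, w, hx, hy, hz, hw, rfl, rfl, hyz, hxw, hsum⟩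
    have hwx : w * x = 0 := by
      simpa [(IsSelfAdjoint.of_nonneg hx.1).star_eq, (IsSelfAdjoint.of_nonneg hw.1).star_eq]
        using congrArg star hxw
    have hu : x + y - (x + z) = y - z := by abel
    have hv : 1 - (x + y) - (x + z) = w - x := by rw [← hsum]; abel
    rw [hu, hv, oabs_sub_of_mul_eq_zero hy.1 hz.1 hyz, oabs_sub_of_mul_eq_zero hw.1 hx.1 hwx,
      ← hsum]
    abel
end
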